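/- For every integer r ≥ 1 and all natural numbers m > n ≥ 0, the number of ballot paths to (n,m) containing no r consecutive N-steps is given by t_n(m;r) = ∑_{i=0}^{m-n-1} (1/(m+1-i)) · ⟨i-m+n choose i⟩_r · ⟨m+1-i choose m-i⟩_r, an identity in ℚ. -/

import Mathlib

/-- A word in steps `N = true` (up, `(0,1)`) and `E = false` (right, `(1,0)`) is a
ballot word when every prefix has at least as many `N`-steps as `E`-steps,
i.e. the corresponding lattice path from `(0,0)` stays weakly above `y = x`. -/
def IsBallot (p : List Bool) : Prop :=
  ∀ q : List Bool, q <+: p → q.count false ≤ q.count true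

/-- `tCount r n m` is the number of ballot paths from `(0,0)` to `(n,m)`
(with `n` east-steps and `m` north-steps, staying weakly above `y = x`)
containing no `r` consecutive north-steps. -/
noncomputable def tCount (r n m : ℕ) : ℕ :=
  Set.ncard {p : List Bool |
    p.count false = n ∧ p.count true = m ∧ IsBallot p ∧ ¬ List.replicate r true <:+: p}

/-- The Euler coefficient `⟨x choose k⟩_r` for a natural number `x`: the
coefficient of `t^k` in `(1 + t + ⋯ + t^(r-1))^x`. -/
noncomputable def eulerCoeffQ (r x k : ℕ) : ℚ :=
  ((∑ i ∈ Finset.range r, (Polynomial.X : Polynomial ℚ) ^ i) ^ x).coeff k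

/-- The Euler coefficient `⟨-y choose k⟩_r` for a negative upper index `-y`
(`y > 0`): the coefficient of `t^k` in the formal power series
`(1 - t)^y * ((1 - t^r)⁻¹)^y = ((1 - t^r)/(1 - t))^(-y)`. -/
noncomputable def eulerCoeffNeg (r y k : ℕ) : ℚ :=
  PowerSeries.coeff (R := ℚ) k
    ((1 - PowerSeries.X) ^ y * ((1 - PowerSeries.X ^ r : PowerSeries ℚ)⁻¹) ^ y)

open PowerSeries in
/-- If each `c n` is the `n`-th coefficient of `f ^ n * (f - ∑ k < n, c k * (X / f) ^ k)`, then
`∑ c k * (X / f) ^ k` expands `f`. Here `g` is the inverse of `f`. -/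
lemma X_pow_dvd_sub_expansion {f g : ℚ⟦X⟧} (hfg : f * g = 1) (hf : constantCoeff f = 1)
    {c : ℕ → ℚ}
    (hc : ∀ n, c n = coeff n (f ^ (n + 1) - ∑ k ∈ Finset.range n, C (c k) * X ^ k * f ^ (n - k)))
    (N : ℕ) :
    X ^ N ∣ f - ∑ k ∈ Finset.range N, C (c k) * X ^ k * g ^ k := by
  induction N with
  | zero => simp
  | succ N ih =>
    have hpow : ∀ k ≤ N, f ^ N * g ^ k = f ^ (N - k) := by
      intro k hk
      obtain ⟨d, rfl⟩ := Nat.exists_eq_add_of_le hk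
      rw [Nat.add_sub_cancel_left, add_comm k d, pow_add, mul_assoc, ← mul_pow, hfg]
      simp
    obtain ⟨h, hh⟩ := ih
    have hexp : f ^ N * (X ^ N * h) =
        f ^ (N + 1) - ∑ k ∈ Finset.range N, C (c k) * X ^ k * f ^ (N - k) := by
      rw [← hh, mul_sub, ← pow_succ, Finset.mul_sum]
      congr 1
      refine Finset.sum_congr rfl fun k hk => ?_
      rw [← hpow k (Finset.mem_range.1 hk).le]
      ring
    have hcN : c N = constantCoeff h := by
      rw [hc N, ← hexp, mul_left_comm]
      simpa [hf] using coeff_X_pow_mul (f ^ N * h) N 0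
    have hg : constantCoeff g = 1 := by
      have := congrArg constantCoeff hfg
      simpa [hf] using this
    have hdvd : X ∣ h - C (c N) * g ^ N := by
      rw [X_dvd_iff]
      simp [hg, hcN]
    rw [Finset.sum_range_succ, ← sub_sub, hh, pow_succ]
    have : X ^ N * h - C (c N) * X ^ N * g ^ N = X ^ N * (h - C (c N) * g ^ N) := by ring
    rw [this]
    exact mul_dvd_mul_left _ hdvd

open PowerSeries in
lemma coeff_pow_succ_mul_derivative_X_mul_inv {f g : ℚ⟦X⟧} (hfg : f * g = 1) (j : ℕ) :
    coeff j (f ^ (j + 1) * derivative ℚ (X * g)) = if j = 0 then 1 else 0 := by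
  have hD : derivative ℚ f * g + f * derivative ℚ g = 0 := by
    have := congrArg (derivative ℚ) hfg
    rw [Derivation.leibniz] at this
    simp only [smul_eq_mul, Derivation.map_one_eq_zero] at this
    linear_combination this
  have hX : derivative ℚ (X * g) = g + X * derivative ℚ g := by
    rw [Derivation.leibniz]
    simp only [smul_eq_mul, derivative_X]
    ring
  rw [hX]
  cases j with
  | zero =>
    have : f ^ (0 + 1) * (g + X * derivative ℚ g) = 1 + X * (f * derivative ℚ g) := by
      linear_combination hfg
    rw [this]
    simp
  | succ i =>
    have hD2 : ((i : ℚ⟦X⟧) + 1) * (f ^ (i + 1 + 1) * (g + X * derivative ℚ g)) =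
        ((i : ℚ⟦X⟧) + 1) * f ^ (i + 1) - X * derivative ℚ (f ^ (i + 1)) := by
      rw [Derivation.leibniz_pow]
      simp only [smul_eq_mul, nsmul_eq_mul, Nat.add_sub_cancel]
      push_cast
      linear_combination ((i : ℚ⟦X⟧) + 1) * (f ^ (i + 1) * hfg +
        X * f ^ (i + 1) * hD - X * f ^ i * derivative ℚ f * hfg)
    have hi : ((i : ℚ⟦X⟧) + 1) = C ((i : ℚ) + 1) := by simp
    rw [hi] at hD2
    have h1 := congrArg (coeff (i + 1)) hD2
    rw [map_sub, coeff_C_mul, coeff_C_mul, coeff_succ_X_mul, coeff_derivative] at h1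
    have h2 : ((i : ℚ) + 1) ≠ 0 := by positivity
    rw [if_neg (Nat.succ_ne_zero i)]
    have h3 : ((i : ℚ) + 1) *
        coeff (i + 1) (f ^ (i + 1 + 1) * (g + X * derivative ℚ g)) = 0 := by
      rw [h1]; ring
    exact (mul_eq_zero.1 h3).resolve_left h2

open PowerSeries in
/-- Lagrange inversion for the expansion of `f` in powers of `X * g`, where `g = f⁻¹`. -/
lemma coeff_pow_succ_eq_of_expansion {f g : ℚ⟦X⟧} (hfg : f * g = 1) {c : ℕ → ℚ} {n : ℕ}
    (hc : X ^ (n + 1) ∣ f - ∑ k ∈ Finset.range (n + 1), C (c k) * X ^ k * g ^ k) :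
    coeff n (f ^ (n + 1)) = ((n : ℚ) + 1) * c n := by
  obtain ⟨h, hh⟩ := hc
  have hφ : X - ∑ k ∈ Finset.range (n + 1), C (c k) * (X * g) ^ (k + 1) =
      X ^ (n + 2) * (g * h) := by
    have hs : ∑ k ∈ Finset.range (n + 1), C (c k) * (X * g) ^ (k + 1) =
        X * g * ∑ k ∈ Finset.range (n + 1), C (c k) * X ^ k * g ^ k := by
      rw [Finset.mul_sum]
      exact Finset.sum_congr rfl fun k _ => by ring
    rw [hs]
    linear_combination X * g * hh - X * hfg
  have hder := congrArg (derivative ℚ) hφ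
  rw [map_sub, derivative_X, map_sum, Derivation.leibniz, Derivation.leibniz_pow] at hder
  have hterm : ∀ k ∈ Finset.range (n + 1),
      coeff n (f ^ (n + 1) * derivative ℚ (C (c k) * (X * g) ^ (k + 1))) =
        if k = n then ((n : ℚ) + 1) * c n else 0 := by
    intro k hk
    obtain ⟨d, rfl⟩ := Nat.exists_eq_add_of_le (Nat.lt_succ_iff.1 (Finset.mem_range.1 hk))
    have hpow : f ^ (k + d + 1) * g ^ k = f ^ (d + 1) := by
      rw [show k + d + 1 = (d + 1) + k by ring, pow_add, mul_assoc, ← mul_pow, hfg]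
      simp
    have : f ^ (k + d + 1) * derivative ℚ (C (c k) * (X * g) ^ (k + 1)) =
        C (c k * (k + 1)) * (X ^ k * (f ^ (d + 1) * derivative ℚ (X * g))) := by
      rw [Derivation.leibniz, derivative_C, Derivation.leibniz_pow, ← hpow]
      simp only [smul_eq_mul, nsmul_eq_mul, Nat.add_sub_cancel, map_mul, map_add, map_natCast,
        map_one, mul_zero, add_zero]
      push_cast
      ring
    rw [this, coeff_C_mul, add_comm k d, coeff_X_pow_mul,
      coeff_pow_succ_mul_derivative_X_mul_inv hfg]
    by_cases hd : d = 0
    · subst hd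
      simp [mul_comm]
    · simp [hd]
  have hmul := congrArg (fun u => coeff n (f ^ (n + 1) * u)) hder
  simp only [mul_sub, mul_one, map_sub, Finset.mul_sum, map_sum] at hmul
  rw [Finset.sum_congr rfl hterm, Finset.sum_ite_eq' (Finset.range (n + 1)) n,
    if_pos (Finset.self_mem_range_succ n)] at hmul
  have hd : X ^ (n + 1) ∣ f ^ (n + 1) * ((X : ℚ⟦X⟧) ^ (n + 2) • derivative ℚ (g * h) +
      (g * h) • (n + 2) • (X : ℚ⟦X⟧) ^ (n + 2 - 1) • derivative ℚ (X : ℚ⟦X⟧)) := by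
    refine ⟨f ^ (n + 1) * (X * derivative ℚ (g * h) + (g * h) * ((n : ℚ⟦X⟧) + 2)), ?_⟩
    simp only [smul_eq_mul, nsmul_eq_mul, derivative_X, show n + 2 - 1 = n + 1 from rfl]
    push_cast
    ring
  rw [X_pow_dvd_iff.1 hd n (Nat.lt_succ_self n)] at hmul
  linarith

open PowerSeries in
lemma coeff_sub_eq_sum_inv_pow {f g : ℚ⟦X⟧} (hfg : f * g = 1) {c : ℕ → ℚ} {n m : ℕ}
    (hnm : n < m)
    (hc : X ^ (m + 1) ∣ f - ∑ k ∈ Finset.range (m + 1), C (c k) * X ^ k * g ^ k) :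
    coeff m (f ^ (n + 1) - ∑ k ∈ Finset.range n, C (c k) * X ^ k * f ^ (n - k)) =
      ∑ i ∈ Finset.range (m - n), c (m - i) * coeff i (g ^ (m - n - i)) := by
  obtain ⟨d, rfl⟩ := Nat.exists_eq_add_of_lt hnm
  have hzero := X_pow_dvd_iff.1 (hc.mul_left (f ^ n)) (n + d + 1) (Nat.lt_succ_self _)
  have hsplit : f ^ n * (f - ∑ k ∈ Finset.range (n + d + 1 + 1), C (c k) * X ^ k * g ^ k) =
      f ^ (n + 1) - ∑ k ∈ Finset.range n, C (c k) * X ^ k * f ^ (n - k) - C (c n) * X ^ n -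
        ∑ j ∈ Finset.range (d + 1), C (c (n + 1 + j)) * X ^ (n + 1 + j) * g ^ (j + 1) := by
    rw [show n + d + 1 + 1 = (n + 1) + (d + 1) by ring, Finset.sum_range_add,
      Finset.sum_range_succ, mul_sub, mul_add, mul_add, Finset.mul_sum, Finset.mul_sum,
      ← pow_succ, ← sub_sub, ← sub_sub]
    have hfgn : f ^ n * g ^ n = 1 := by rw [← mul_pow, hfg, one_pow]
    congr 1
    · congr 1
      · congr 1
        refine Finset.sum_congr rfl fun k hk => ?_
        obtain ⟨e, he⟩ := Nat.exists_eq_add_of_le (Finset.mem_range.1 hk).le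
        have hk1 : f ^ k * g ^ k = 1 := by rw [← mul_pow, hfg, one_pow]
        rw [he, Nat.add_sub_cancel_left, pow_add]
        linear_combination C (c k) * X ^ k * f ^ e * hk1
      · linear_combination C (c n) * X ^ n * hfgn
    · refine Finset.sum_congr rfl fun j _ => ?_
      rw [show n + 1 + j = n + (j + 1) by ring, pow_add g]
      linear_combination C (c (n + (j + 1))) * X ^ (n + (j + 1)) * g ^ (j + 1) * hfgn
  rw [hsplit, map_sub, map_sub (coeff (n + d + 1)) (_ - _) (C (c n) * X ^ n), coeff_C_mul,
    coeff_X_pow, if_neg (by omega), mul_zero, sub_zero, sub_eq_zero] at hzero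
  rw [hzero, map_sum, ← Finset.sum_range_reflect, show n + d + 1 - n = d + 1 by omega]
  refine Finset.sum_congr rfl fun i hi => ?_
  have hi' := Finset.mem_range.1 hi
  rw [show n + 1 + (d + 1 - 1 - i) = n + d + 1 - i by omega,
    show d + 1 - 1 - i + 1 = d + 1 - i by omega, mul_assoc, coeff_C_mul, coeff_X_pow_mul',
    if_pos (by omega), show n + d + 1 - (n + d + 1 - i) = i by omega]

lemma isBallot_concat (p : List Bool) (x : Bool) :
    IsBallot (p ++ [x]) ↔
      IsBallot p ∧ (p ++ [x]).count false ≤ (p ++ [x]).count true := by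
  unfold IsBallot
  simp only [List.prefix_concat_iff]
  constructor
  · intro h
    exact ⟨fun q hq => h q (Or.inr hq), h _ (Or.inl rfl)⟩
  · rintro ⟨h1, h2⟩ q (rfl | hq)
    · exact h2
    · exact h1 q hq

lemma isBallot_append_false_replicate (q : List Bool) (a : ℕ) :
    IsBallot (q ++ false :: List.replicate a true) ↔
      IsBallot q ∧ q.count false + 1 ≤ q.count true := by
  induction a with
  | zero => simp [isBallot_concat]
  | succ a ih =>
    rw [List.replicate_succ', ← List.cons_append, ← List.append_assoc, isBallot_concat, ih]
    simp only [List.count_append, List.count_cons, List.count_replicate, List.count_nil]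
    simp
    omega

lemma isBallot_replicate (a : ℕ) : IsBallot (List.replicate a true) := by
  intro q hq
  have : q.count false ≤ (List.replicate a true).count false := hq.sublist.count_le false
  simp [List.count_replicate] at this
  simp [this]

lemma replicate_infix_append_false_replicate {r : ℕ} (hr : 1 ≤ r) (q : List Bool) (a : ℕ) :
    List.replicate r true <:+: q ++ false :: List.replicate a true ↔
      List.replicate r true <:+: q ∨ r ≤ a := by
  constructor
  · rintro ⟨s, t, h⟩
    rw [List.append_assoc] at h
    rcases List.append_eq_append_iff.1 h with ⟨u, hu, hv⟩ | ⟨u, hu, hv⟩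
    · rcases List.append_eq_append_iff.1 hv with ⟨w, hw, hz⟩ | ⟨w, hw, hz⟩
      · exact Or.inl ⟨s, w, by rw [hu, hw, List.append_assoc]⟩
      · rcases w with _ | ⟨b, w⟩
        · exact Or.inl ⟨s, [], by rw [hu, hw]; simp⟩
        · exfalso
          simp only [List.cons_append, List.cons.injEq] at hz
          have : false ∈ List.replicate r true := by
            rw [hw, ← hz.1]; simp
          simp at this
    · right
      rcases u with _ | ⟨b, u⟩
      · exfalso
        obtain ⟨r, rfl⟩ := Nat.exists_eq_add_of_le' hr
        simp [List.replicate_succ] at hv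
      · simp only [List.cons_append, List.cons.injEq] at hv
        have := congrArg List.length hv.2
        simp at this
        omega
  · rintro (h | h)
    · exact h.trans (List.prefix_append _ _).isInfix
    · refine List.IsInfix.trans ?_ (List.suffix_append q _).isInfix
      refine List.IsInfix.trans ?_ (List.suffix_cons false _).isInfix
      obtain ⟨d, rfl⟩ := Nat.exists_eq_add_of_le h
      rw [List.replicate_add]
      exact (List.prefix_append _ _).isInfix

lemma exists_eq_append_false_replicate {p : List Bool} (h : 0 < p.count false) :
    ∃ q a, p = q ++ false :: List.replicate a true := by
  induction p using List.reverseRecOn with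
  | nil => simp at h
  | append_singleton p x ih =>
    cases x with
    | false => exact ⟨p, 0, by simp⟩
    | true =>
      obtain ⟨q, a, rfl⟩ := ih (by simpa using h)
      exact ⟨q, a + 1, by rw [List.replicate_succ']; simp⟩

lemma append_false_replicate_inj {q q' : List Bool} {a a' : ℕ}
    (h : q ++ false :: List.replicate a true = q' ++ false :: List.replicate a' true) :
    a = a' ∧ q = q' := by
  induction a generalizing a' with
  | zero =>
    cases a' with
    | zero => simpa using h
    | succ a' =>
      rw [List.replicate_succ', ← List.cons_append, ← List.append_assoc] at h
      have := (List.append_inj' h rfl).2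
      simp at this
  | succ a ih =>
    cases a' with
    | zero =>
      rw [List.replicate_succ', ← List.cons_append, ← List.append_assoc] at h
      have := (List.append_inj' h rfl).2
      simp at this
    | succ a' =>
      rw [List.replicate_succ', List.replicate_succ', ← List.cons_append, ← List.append_assoc,
        ← List.cons_append, ← List.append_assoc] at h
      obtain ⟨h1, h2⟩ := ih (List.append_inj' h rfl).1
      exact ⟨by rw [h1], h2⟩

lemma finite_ballotPaths (r n m : ℕ) : {p : List Bool |
    p.count false = n ∧ p.count true = m ∧ IsBallot p ∧
      ¬ List.replicate r true <:+: p}.Finite := by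
  refine (List.finite_length_eq Bool (n + m)).subset ?_
  rintro p ⟨h1, h2, -, -⟩
  have := List.count_false_add_count_true p
  simp only [Set.mem_ofPred_eq]
  omega

/-- The ballot paths counted by `tCount`, as a finset. -/
noncomputable def ballotPaths (r n m : ℕ) : Finset (List Bool) :=
  (finite_ballotPaths r n m).toFinset

lemma card_ballotPaths (r n m : ℕ) : (ballotPaths r n m).card = tCount r n m :=
  (Set.ncard_eq_toFinset_card _ _).symm

lemma mem_ballotPaths {r n m : ℕ} {p : List Bool} : p ∈ ballotPaths r n m ↔
    p.count false = n ∧ p.count true = m ∧ IsBallot p ∧ ¬ List.replicate r true <:+: p := by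
  simp [ballotPaths]

lemma ballotPaths_succ {r : ℕ} (hr : 1 ≤ r) (n m : ℕ) :
    ballotPaths r (n + 1) m = {a ∈ Finset.range r | n + 1 + a ≤ m}.biUnion fun a =>
      (ballotPaths r n (m - a)).image fun q => q ++ false :: List.replicate a true := by
  ext p
  simp only [Finset.mem_biUnion, Finset.mem_filter, Finset.mem_range, Finset.mem_image,
    mem_ballotPaths]
  constructor
  · rintro ⟨h1, h2, h3, h4⟩
    obtain ⟨q, a, rfl⟩ := exists_eq_append_false_replicate (p := p) (by omega)
    rw [replicate_infix_append_false_replicate hr] at h4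
    rw [isBallot_append_false_replicate] at h3
    push Not at h4
    simp [List.count_replicate] at h1 h2
    exact ⟨a, ⟨h4.2, by omega⟩, q, ⟨h1, by omega, h3.1, h4.1⟩, rfl⟩
  · rintro ⟨a, ⟨ha, hm⟩, q, ⟨h1, h2, h3, h4⟩, rfl⟩
    rw [replicate_infix_append_false_replicate hr, isBallot_append_false_replicate]
    simp only [List.count_append, List.count_cons, List.count_replicate]
    refine ⟨by simp [h1], ?_, ⟨h3, by omega⟩, ?_⟩
    · simp
      omega
    · push Not
      exact ⟨h4, ha⟩

lemma tCount_succ {r : ℕ} (hr : 1 ≤ r) (n m : ℕ) :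
    tCount r (n + 1) m = ∑ a ∈ Finset.range r with n + 1 + a ≤ m, tCount r n (m - a) := by
  rw [← card_ballotPaths, ballotPaths_succ hr, Finset.card_biUnion]
  · refine Finset.sum_congr rfl fun a _ => ?_
    rw [Finset.card_image_of_injective _ fun q q' h => (append_false_replicate_inj h).2,
      card_ballotPaths]
  · intro a _ b _ hab
    rw [Function.onFun, Finset.disjoint_left]
    intro p hp hp'
    obtain ⟨q, -, rfl⟩ := Finset.mem_image.1 hp
    obtain ⟨q', -, h⟩ := Finset.mem_image.1 hp'
    exact hab (append_false_replicate_inj h).1.symm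

lemma tCount_zero (r m : ℕ) : tCount r 0 m = if m < r then 1 else 0 := by
  have key : ∀ p : List Bool, p.count false = 0 ∧ p.count true = m ↔
      p = List.replicate m true := by
    intro p
    constructor
    · rintro ⟨h1, h2⟩
      have hl := List.count_false_add_count_true p
      refine List.eq_replicate_iff.2 ⟨by omega, fun b hb => ?_⟩
      cases b
      · exact absurd hb (List.count_eq_zero.1 h1)
      · rfl
    · rintro rfl
      simp [List.count_replicate]
  have hinf : List.replicate r true <:+: List.replicate m true ↔ r ≤ m := by
    constructor
    · intro h
      simpa using h.length_le
    · intro h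
      obtain ⟨d, rfl⟩ := Nat.exists_eq_add_of_le h
      rw [List.replicate_add]
      exact (List.prefix_append _ _).isInfix
  unfold tCount
  split_ifs with h
  · rw [Set.ncard_eq_one]
    refine ⟨List.replicate m true, ?_⟩
    ext p
    simp only [Set.mem_ofPred_eq, Set.mem_singleton_iff, ← and_assoc, key]
    constructor
    · exact fun hp => hp.1.1
    · rintro rfl
      exact ⟨⟨rfl, isBallot_replicate m⟩, by rw [hinf]; omega⟩
  · convert Set.ncard_empty (List Bool)
    ext p
    simp only [Set.mem_ofPred_eq, Set.mem_empty_iff_false, iff_false, ← and_assoc, key]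
    rintro ⟨⟨rfl, -⟩, hp⟩
    rw [hinf] at hp
    omega

lemma tCount_eq_zero_of_lt {r n m : ℕ} (h : m < n) : tCount r n m = 0 := by
  rw [← card_ballotPaths, Finset.card_eq_zero, Finset.eq_empty_iff_forall_notMem]
  intro p hp
  obtain ⟨h1, h2, h3, -⟩ := mem_ballotPaths.1 hp
  have := h3 p List.prefix_rfl
  omega

open PowerSeries in
lemma coeff_geom_sum_mul (r m : ℕ) (u : ℚ⟦X⟧) :
    coeff m ((∑ i ∈ Finset.range r, (X : ℚ⟦X⟧) ^ i) * u) =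
      ∑ a ∈ Finset.range r, if a ≤ m then coeff (m - a) u else 0 := by
  rw [Finset.sum_mul, map_sum]
  exact Finset.sum_congr rfl fun a _ => coeff_X_pow_mul' u a m

open PowerSeries in
lemma mk_tCount_succ {r : ℕ} (hr : 1 ≤ r) (n : ℕ) :
    (mk fun m => (tCount r (n + 1) m : ℚ)) = (∑ i ∈ Finset.range r, (X : ℚ⟦X⟧) ^ i) *
      ((mk fun m => (tCount r n m : ℚ)) - C (tCount r n n : ℚ) * X ^ n) := by
  ext m
  rw [coeff_geom_sum_mul, coeff_mk, tCount_succ hr, Nat.cast_sum, Finset.sum_filter]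
  refine Finset.sum_congr rfl fun a _ => ?_
  simp only [map_sub, coeff_mk, coeff_C_mul, coeff_X_pow]
  rcases lt_trichotomy m (n + a) with h | h | h
  · rw [if_neg (by omega)]
    split_ifs with h1 h2
    · omega
    · rw [tCount_eq_zero_of_lt (by omega)]
      simp
    · rfl
  · subst h
    simp
  · rw [if_pos (by omega), if_pos (by omega), if_neg (by omega)]
    simp

open PowerSeries in
lemma mk_tCount {r : ℕ} (hr : 1 ≤ r) (n : ℕ) :
    (mk fun m => (tCount r n m : ℚ)) = (∑ i ∈ Finset.range r, (X : ℚ⟦X⟧) ^ i) ^ (n + 1) -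
      ∑ k ∈ Finset.range n, C (tCount r k k : ℚ) * X ^ k *
        (∑ i ∈ Finset.range r, (X : ℚ⟦X⟧) ^ i) ^ (n - k) := by
  induction n with
  | zero =>
    ext m
    simp [tCount_zero, coeff_X_pow]
  | succ n ih =>
    rw [mk_tCount_succ hr, ih, Finset.sum_range_succ, mul_sub, mul_sub, Finset.mul_sum,
      ← pow_succ', ← sub_sub]
    congr 1
    · congr 1
      refine Finset.sum_congr rfl fun k hk => ?_
      rw [Nat.succ_sub (Finset.mem_range.1 hk).le, pow_succ]
      ring
    · rw [Nat.add_sub_cancel_left, pow_one]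
      ring

open PowerSeries in
lemma eulerCoeffQ_eq_coeff (r x k : ℕ) :
    eulerCoeffQ r x k = coeff k ((∑ i ∈ Finset.range r, (X : ℚ⟦X⟧) ^ i) ^ x) := by
  have : (∑ i ∈ Finset.range r, (X : ℚ⟦X⟧) ^ i) =
      ((∑ i ∈ Finset.range r, (Polynomial.X : Polynomial ℚ) ^ i : Polynomial ℚ) : ℚ⟦X⟧) := by
    rw [← Polynomial.coeToPowerSeries.ringHom_apply, map_sum]
    simp
  rw [this, ← Polynomial.coe_pow, Polynomial.coeff_coe, eulerCoeffQ]

open PowerSeries in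
lemma geom_sum_mul_one_sub_X_mul_inv {r : ℕ} (hr : 1 ≤ r) :
    (∑ i ∈ Finset.range r, (X : ℚ⟦X⟧) ^ i) * ((1 - X) * (1 - X ^ r : ℚ⟦X⟧)⁻¹) = 1 := by
  rw [← mul_assoc, geom_sum_mul_neg]
  apply PowerSeries.mul_inv_cancel
  simp [show r ≠ 0 by omega]

theorem tCount_formula (r : ℕ) (hr : 1 ≤ r) (n m : ℕ) (h : n < m) :
    (tCount r n m : ℚ) =
      ∑ i ∈ Finset.range (m - n),
        (1 / ((m : ℚ) + 1 - i)) * eulerCoeffNeg r (m - n - i) i *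
          eulerCoeffQ r (m + 1 - i) (m - i) := by
  have hfg := geom_sum_mul_one_sub_X_mul_inv hr
  have hf : PowerSeries.constantCoeff
      (∑ i ∈ Finset.range r, (PowerSeries.X : PowerSeries ℚ) ^ i) = 1 := by
    obtain ⟨s, rfl⟩ := Nat.exists_eq_add_of_le' hr
    simp [Finset.sum_range_succ']
  have hcoeff : ∀ n m, (tCount r n m : ℚ) = PowerSeries.coeff m
      ((∑ i ∈ Finset.range r, (PowerSeries.X : PowerSeries ℚ) ^ i) ^ (n + 1) -
        ∑ k ∈ Finset.range n, PowerSeries.C (tCount r k k : ℚ) * PowerSeries.X ^ k *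
          (∑ i ∈ Finset.range r, (PowerSeries.X : PowerSeries ℚ) ^ i) ^ (n - k)) := by
    intro n m
    rw [← mk_tCount hr, PowerSeries.coeff_mk]
  have hdvd := X_pow_dvd_sub_expansion (c := fun k => (tCount r k k : ℚ)) hfg hf
    fun n => hcoeff n n
  rw [hcoeff, coeff_sub_eq_sum_inv_pow (c := fun k => (tCount r k k : ℚ)) hfg h (hdvd _)]
  refine Finset.sum_congr rfl fun i hi => ?_
  have him : i ≤ m := by have := Finset.mem_range.1 hi; omega
  have hpos : (m : ℚ) + 1 - i ≠ 0 := by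
    have : (i : ℚ) ≤ m := by exact_mod_cast him
    linarith
  rw [eulerCoeffQ_eq_coeff, show m + 1 - i = m - i + 1 by omega,
    coeff_pow_succ_eq_of_expansion (c := fun k => (tCount r k k : ℚ)) hfg (hdvd _),
    eulerCoeffNeg, ← mul_pow, Nat.cast_sub him]
  field_simp
  ring
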